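/- Let M̄ = M₁ ×_{(f₁,f₂)} M₂ be a base conformal warped product with metric ḡ = f₁²g ⊕ f₂²h, dim M₁ = m, dim M₂ = n. Then the fiber Ricci components satisfy Ric̄(∂_α,∂_β) = Ric^{M₂}(∂_α,∂_β) − (f₂²/f₁²) h(∂_α,∂_β) [ (m−2) g(∇f₂,∇f₁)/(f₁f₂) + Δ_{M₁}f₂/f₂ + (n−1) g(∇f₂,∇f₂)/f₂² ]. -/

import Mathlib

noncomputable section

open Matrix

variable {ι : Type*} [Fintype ι] [DecidableEq ι]

/-- Partial derivative in the `i`-th coordinate direction. -/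
def pd (i : ι) (φ : (ι → ℝ) → ℝ) (x : ι → ℝ) : ℝ :=
  fderiv ℝ φ x (Pi.single i 1)

/-- Christoffel symbols `Γ^k_{ij}` of a coordinate metric. -/
def christoffel (g : (ι → ℝ) → Matrix ι ι ℝ) (k i j : ι) (x : ι → ℝ) : ℝ :=
  (1 / 2) * ∑ l, (g x)⁻¹ k l *
    (pd i (fun y => g y l j) x + pd j (fun y => g y l i) x - pd l (fun y => g y i j) x)

/-- Ricci curvature components `R_{ij}` of a coordinate metric. -/
def ricci (g : (ι → ℝ) → Matrix ι ι ℝ) (i j : ι) (x : ι → ℝ) : ℝ :=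
  (∑ k, (pd k (christoffel g k i j) x - pd j (christoffel g k i k) x))
  + ∑ k, ∑ l, (christoffel g k k l x * christoffel g l i j x
      - christoffel g k j l x * christoffel g l i k x)

/-- Scalar curvature of a coordinate metric. -/
def scalarCurv (g : (ι → ℝ) → Matrix ι ι ℝ) (x : ι → ℝ) : ℝ :=
  ∑ i, ∑ j, (g x)⁻¹ i j * ricci g i j x

/-- Hessian `H_φ(∂_i,∂_j)` with respect to the Levi-Civita connection of `g`. -/
def hess (g : (ι → ℝ) → Matrix ι ι ℝ) (φ : (ι → ℝ) → ℝ) (i j : ι) (x : ι → ℝ) : ℝ :=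
  pd i (pd j φ) x - ∑ k, christoffel g k i j x * pd k φ x

/-- Laplace–Beltrami operator of `g`. -/
def laplacian (g : (ι → ℝ) → Matrix ι ι ℝ) (φ : (ι → ℝ) → ℝ) (x : ι → ℝ) : ℝ :=
  ∑ i, ∑ j, (g x)⁻¹ i j * hess g φ i j x

/-- Inner product of gradients `g(∇φ,∇ψ)`. -/
def gradInner (g : (ι → ℝ) → Matrix ι ι ℝ) (φ ψ : (ι → ℝ) → ℝ) (x : ι → ℝ) : ℝ :=
  ∑ i, ∑ j, (g x)⁻¹ i j * pd i φ x * pd j ψ x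

/-- Einstein tensor `G_{ij} = R_{ij} - (1/2) S g_{ij}`. -/
def einstein (g : (ι → ℝ) → Matrix ι ι ℝ) (i j : ι) (x : ι → ℝ) : ℝ :=
  ricci g i j x - (1 / 2) * scalarCurv g x * g x i j

/-- A (pseudo-Riemannian) coordinate metric: symmetric, everywhere invertible and smooth. -/
def IsMetric (g : (ι → ℝ) → Matrix ι ι ℝ) : Prop :=
  (∀ x, (g x).IsSymm) ∧ (∀ x, IsUnit (g x).det) ∧
    ∀ i j, ContDiff ℝ (⊤ : ℕ∞) (fun x => g x i j)

/-- A Riemannian coordinate metric. -/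
def IsRiemannMetric (g : (ι → ℝ) → Matrix ι ι ℝ) : Prop :=
  (∀ x, (g x).PosDef) ∧ ∀ i j, ContDiff ℝ (⊤ : ℕ∞) (fun x => g x i j)

/-- The base conformal warped product metric `ḡ = f₁²g ⊕ f₂²h` on `M₁ × M₂`,
where `f₁, f₂` depend only on the points of the base `M₁`. -/
def bcwpMetric {m n : ℕ} (g : (Fin m → ℝ) → Matrix (Fin m) (Fin m) ℝ)
    (h : (Fin n → ℝ) → Matrix (Fin n) (Fin n) ℝ)
    (f₁ f₂ : (Fin m → ℝ) → ℝ) :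
    ((Fin m ⊕ Fin n) → ℝ) → Matrix (Fin m ⊕ Fin n) (Fin m ⊕ Fin n) ℝ :=
  fun x => Matrix.fromBlocks ((f₁ (x ∘ Sum.inl)) ^ 2 • g (x ∘ Sum.inl)) 0 0
    ((f₂ (x ∘ Sum.inl)) ^ 2 • h (x ∘ Sum.inr))

set_option linter.unusedSectionVars false

section CoordinateCalculus

lemma pd_eq_of_hasFDerivAt {i : ι} {φ : (ι → ℝ) → ℝ} {φ' : (ι → ℝ) →L[ℝ] ℝ} {x : ι → ℝ}
    (hφ : HasFDerivAt φ φ' x) : pd i φ x = φ' (Pi.single i 1) := by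
  rw [pd, hφ.fderiv]

lemma pd_const (i : ι) (c : ℝ) (x : ι → ℝ) : pd i (fun _ => c) x = 0 := by
  simp [pd]

lemma pd_mul (i : ι) {φ ψ : (ι → ℝ) → ℝ} {x : ι → ℝ} (hφ : DifferentiableAt ℝ φ x)
    (hψ : DifferentiableAt ℝ ψ x) :
    pd i (fun y => φ y * ψ y) x = pd i φ x * ψ x + φ x * pd i ψ x := by
  rw [pd_eq_of_hasFDerivAt (hφ.hasFDerivAt.fun_mul hψ.hasFDerivAt)]
  simp [pd]
  ring

lemma pd_sum (i : ι) {κ : Type*} (s : Finset κ) {φ : κ → (ι → ℝ) → ℝ} {x : ι → ℝ}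
    (hφ : ∀ k ∈ s, DifferentiableAt ℝ (φ k) x) :
    pd i (fun y => ∑ k ∈ s, φ k y) x = ∑ k ∈ s, pd i (φ k) x := by
  rw [pd_eq_of_hasFDerivAt (HasFDerivAt.fun_sum fun k hk => (hφ k hk).hasFDerivAt)]
  simp [pd]

lemma pd_sum_mul (i : ι) {κ : Type*} [Fintype κ] {φ ψ : κ → (ι → ℝ) → ℝ} {x : ι → ℝ}
    (hφ : ∀ k, DifferentiableAt ℝ (φ k) x) (hψ : ∀ k, DifferentiableAt ℝ (ψ k) x) :
    pd i (fun y => ∑ k, φ k y * ψ k y) x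
      = ∑ k, (pd i (φ k) x * ψ k x + φ k x * pd i (ψ k) x) := by
  rw [pd_sum i (φ := fun k y => φ k y * ψ k y) _ fun k _ => (hφ k).fun_mul (hψ k)]
  exact Finset.sum_congr rfl fun k _ => pd_mul i (hφ k) (hψ k)

lemma pd_sq (i : ι) {φ : (ι → ℝ) → ℝ} {x : ι → ℝ} (hφ : DifferentiableAt ℝ φ x) :
    pd i (fun y => φ y ^ 2) x = 2 * φ x * pd i φ x := by
  simp_rw [pow_two]
  rw [pd_mul i hφ hφ]
  ring

lemma pd_inv (i : ι) {φ : (ι → ℝ) → ℝ} {x : ι → ℝ} (hφ : DifferentiableAt ℝ φ x)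
    (h0 : φ x ≠ 0) : pd i (fun y => (φ y)⁻¹) x = -pd i φ x / φ x ^ 2 := by
  have hi : HasFDerivAt (fun y => (φ y)⁻¹) _ x :=
    (hasDerivAt_inv h0).comp_hasFDerivAt x hφ.hasFDerivAt
  rw [pd_eq_of_hasFDerivAt hi]
  simp [pd]
  ring

lemma contDiff_pd (i : ι) {φ : (ι → ℝ) → ℝ} (hφ : ContDiff ℝ (⊤ : ℕ∞) φ) :
    ContDiff ℝ (⊤ : ℕ∞) (pd i φ) :=
  (hφ.fderiv_right (m := (⊤ : ℕ∞)) (by simp)).clm_apply contDiff_const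

lemma hasFDerivAt_precomp {κ : Type*} [Fintype κ] (e : κ → ι) {φ : (κ → ℝ) → ℝ} {x : ι → ℝ}
    (hφ : DifferentiableAt ℝ φ (x ∘ e)) :
    HasFDerivAt (fun y : ι → ℝ => φ (y ∘ e))
      ((fderiv ℝ φ (x ∘ e)).comp
        (ContinuousLinearMap.pi fun k => ContinuousLinearMap.proj (R := ℝ) (e k))) x :=
  HasFDerivAt.comp x (f := fun y : ι → ℝ => y ∘ e) hφ.hasFDerivAt
    (ContinuousLinearMap.pi fun k =>
      ContinuousLinearMap.proj (R := ℝ) (φ := fun _ : ι => ℝ) (e k)).hasFDerivAt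

lemma pd_precomp_apply {κ : Type*} [Fintype κ] [DecidableEq κ] {e : κ → ι}
    (he : Function.Injective e) (k : κ) {φ : (κ → ℝ) → ℝ} {x : ι → ℝ}
    (hφ : DifferentiableAt ℝ φ (x ∘ e)) :
    pd (e k) (fun y : ι → ℝ => φ (y ∘ e)) x = pd k φ (x ∘ e) := by
  rw [pd_eq_of_hasFDerivAt (hasFDerivAt_precomp e hφ), pd, ContinuousLinearMap.comp_apply]
  congr 1
  ext l
  simp [Pi.single_apply, he.eq_iff]

lemma pd_precomp_of_notMem_range {κ : Type*} [Fintype κ] {e : κ → ι} {i : ι}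
    (hi : ∀ k, e k ≠ i) {φ : (κ → ℝ) → ℝ} {x : ι → ℝ}
    (hφ : DifferentiableAt ℝ φ (x ∘ e)) :
    pd i (fun y : ι → ℝ => φ (y ∘ e)) x = 0 := by
  rw [pd_eq_of_hasFDerivAt (hasFDerivAt_precomp e hφ), ContinuousLinearMap.comp_apply]
  convert map_zero (fderiv ℝ φ (x ∘ e)) using 2
  ext l
  simp [hi l]

end CoordinateCalculus

section CoordinateMetric

variable {g : (ι → ℝ) → Matrix ι ι ℝ}

lemma contDiff_matrix_det {A : (ι → ℝ) → Matrix ι ι ℝ}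
    (hA : ∀ i j, ContDiff ℝ (⊤ : ℕ∞) fun x => A x i j) :
    ContDiff ℝ (⊤ : ℕ∞) fun x => (A x).det := by
  simp_rw [Matrix.det_apply']
  exact ContDiff.sum fun σ _ => contDiff_const.mul (contDiff_prod fun i _ => hA _ _)

lemma IsMetric.contDiff_inv (hg : IsMetric g) (i j : ι) :
    ContDiff ℝ (⊤ : ℕ∞) fun x => (g x)⁻¹ i j := by
  simp_rw [Matrix.inv_def, Matrix.smul_apply, Ring.inverse_eq_inv', smul_eq_mul,
    Matrix.adjugate_apply]
  refine ((contDiff_matrix_det hg.2.2).inv fun x => (hg.2.1 x).ne_zero).mul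
    (contDiff_matrix_det fun k l => ?_)
  by_cases hk : k = j
  · subst hk
    simpa using contDiff_const
  · simpa [Matrix.updateRow_ne hk] using hg.2.2 k l

lemma IsMetric.contDiff_christoffel (hg : IsMetric g) (k i j : ι) :
    ContDiff ℝ (⊤ : ℕ∞) (christoffel g k i j) :=
  contDiff_const.mul <| ContDiff.sum fun l _ => (hg.contDiff_inv k l).mul <|
    ((contDiff_pd i (hg.2.2 l j)).add (contDiff_pd j (hg.2.2 l i))).sub
      (contDiff_pd l (hg.2.2 i j))

lemma IsMetric.symm_apply (hg : IsMetric g) (x : ι → ℝ) (i j : ι) : g x i j = g x j i :=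
  (hg.1 x).apply j i

lemma IsMetric.inv_symm_apply (hg : IsMetric g) (x : ι → ℝ) (i j : ι) :
    (g x)⁻¹ i j = (g x)⁻¹ j i :=
  ((hg.1 x).inv).apply j i

lemma IsMetric.pd_symm (hg : IsMetric g) (c i j : ι) (x : ι → ℝ) :
    pd c (fun y => g y i j) x = pd c (fun y => g y j i) x := by
  simp_rw [hg.symm_apply _ i j]

lemma IsMetric.pd_inv_entry (hg : IsMetric g) (c i j : ι) (x : ι → ℝ) :
    pd c (fun y => (g y)⁻¹ i j) x
      = -∑ k, ∑ l, (g x)⁻¹ i k * pd c (fun y => g y k l) x * (g x)⁻¹ l j := by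
  have dG : ∀ i j, DifferentiableAt ℝ (fun y => (g y)⁻¹ i j) x := fun i j =>
    (hg.contDiff_inv i j).differentiable (by simp) x
  have dg : ∀ i j, DifferentiableAt ℝ (fun y => g y i j) x := fun i j =>
    (hg.2.2 i j).differentiable (by simp) x
  set D : Matrix ι ι ℝ := Matrix.of fun i j => pd c (fun y => (g y)⁻¹ i j) x with hD
  set E : Matrix ι ι ℝ := Matrix.of fun i j => pd c (fun y => g y i j) x with hE
  have key : D * g x + (g x)⁻¹ * E = 0 := by
    ext i j
    have h1 : pd c (fun y => ∑ k, (g y)⁻¹ i k * g y k j) x = 0 := by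
      have : (fun y => ∑ k, (g y)⁻¹ i k * g y k j) = fun _ => (1 : Matrix ι ι ℝ) i j := by
        funext y
        rw [← Matrix.mul_apply, Matrix.nonsing_inv_mul _ (hg.2.1 y)]
      rw [this, pd_const]
    rw [pd_sum_mul c (fun k => dG i k) (fun k => dg k j), Finset.sum_add_distrib] at h1
    simpa [Matrix.mul_apply, hD, hE] using h1
  have hDe : D = -((g x)⁻¹ * E * (g x)⁻¹) := by
    have := congrArg (· * (g x)⁻¹) (eq_neg_of_add_eq_zero_left key)
    simpa [Matrix.mul_assoc, Matrix.mul_nonsing_inv _ (hg.2.1 x)] using this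
  have := congrFun (congrFun hDe i) j
  simp only [hD, Matrix.of_apply, Matrix.neg_apply, Matrix.mul_apply, Finset.sum_mul] at this
  rw [this, Finset.sum_comm]
  simp [hE]

lemma IsMetric.sum_christoffel_contract (hg : IsMetric g) (c : ι) (x : ι → ℝ) :
    ∑ a, christoffel g a a c x
      = (1 / 2) * ∑ a, ∑ l, (g x)⁻¹ a l * pd c (fun y => g y a l) x := by
  have h1 : ∑ a, ∑ l, (g x)⁻¹ a l * pd a (fun y => g y l c) x
      = ∑ a, ∑ l, (g x)⁻¹ a l * pd l (fun y => g y a c) x := by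
    rw [Finset.sum_comm]
    simp_rw [hg.inv_symm_apply x]
  simp_rw [christoffel, ← Finset.mul_sum, mul_sub, mul_add, Finset.sum_sub_distrib,
    Finset.sum_add_distrib, h1, fun a l => hg.pd_symm c l a]
  ring

lemma IsMetric.sum_inv_mul_christoffel (hg : IsMetric g) (b : ι) (x : ι → ℝ) :
    ∑ a, ∑ c, (g x)⁻¹ a c * christoffel g b a c x
      = -∑ a, pd a (fun y => (g y)⁻¹ a b) x
        - ∑ c, (g x)⁻¹ c b * ∑ a, christoffel g a a c x := by
  simp_rw [hg.sum_christoffel_contract, hg.pd_inv_entry, christoffel, Finset.mul_sum,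
    Finset.sum_neg_distrib, neg_neg]
  set P : ι → ι → ι → ℝ := fun a c l => pd a (fun y => g y c l) x with hP
  have hs : ∀ a c l, pd a (fun y => g y c l) x = P a c l := fun _ _ _ => rfl
  have hsym : ∀ a c l, P a c l = P a l c := fun a c l => hg.pd_symm a c l x
  set G := (g x)⁻¹ with hG
  have hGs : ∀ i j, G i j = G j i := hg.inv_symm_apply x
  simp_rw [hs]
  have e1 : ∑ a, ∑ c, ∑ l, G a c * (1 / 2 * (G b l * (P a l c + P c l a - P l a c)))
      = (1/2) * (∑ a, ∑ c, ∑ l, G a c * P a c l * G l b)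
        + (1/2) * (∑ a, ∑ c, ∑ l, G a c * P c l a * G l b)
        - ∑ a, ∑ c, ∑ l, G a c * G l b * P l a c * (1/2) := by
    simp_rw [Finset.mul_sum, ← Finset.sum_add_distrib, ← Finset.sum_sub_distrib]
    refine Finset.sum_congr rfl fun a _ => Finset.sum_congr rfl fun c _ =>
      Finset.sum_congr rfl fun l _ => ?_
    rw [hGs b l, hsym a l c]
    ring
  have e2 : ∑ a, ∑ c, ∑ l, G a c * P c l a * G l b
      = ∑ a, ∑ c, ∑ l, G a c * P a c l * G l b := by
    rw [Finset.sum_comm]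
    refine Finset.sum_congr rfl fun a _ => Finset.sum_congr rfl fun c _ =>
      Finset.sum_congr rfl fun l _ => ?_
    rw [hGs c a, hsym a l c]
  have e3 : ∑ l, ∑ a, ∑ c, G l b * (1 / 2 * (G a c * P l a c))
      = ∑ a, ∑ c, ∑ l, G a c * G l b * P l a c * (1/2) := by
    rw [Finset.sum_comm]
    refine Finset.sum_congr rfl fun a _ => ?_
    rw [Finset.sum_comm]
    refine Finset.sum_congr rfl fun c _ => Finset.sum_congr rfl fun l _ => ?_
    ring
  rw [e1, e2, e3]
  ring

lemma IsMetric.laplacian_eq_divergence (hg : IsMetric g) {φ : (ι → ℝ) → ℝ}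
    (hφ : ContDiff ℝ (⊤ : ℕ∞) φ) (x : ι → ℝ) :
    laplacian g φ x
      = ∑ a, pd a (fun y => ∑ b, (g y)⁻¹ a b * pd b φ y) x
        + ∑ a, (∑ c, christoffel g c c a x) * ∑ b, (g x)⁻¹ a b * pd b φ x := by
  have dG : ∀ i j, DifferentiableAt ℝ (fun y => (g y)⁻¹ i j) x := fun i j =>
    (hg.contDiff_inv i j).differentiable (by simp) x
  have dφ : ∀ i, DifferentiableAt ℝ (pd i φ) x := fun i =>
    (contDiff_pd i hφ).differentiable (by simp) x
  have e1 : ∀ a, pd a (fun y => ∑ b, (g y)⁻¹ a b * pd b φ y) x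
      = ∑ b, (pd a (fun y => (g y)⁻¹ a b) x * pd b φ x + (g x)⁻¹ a b * pd a (pd b φ) x) :=
    fun a => pd_sum_mul a (fun b => dG a b) dφ
  have e2 : ∑ a, ∑ c, (g x)⁻¹ a c * ∑ b, christoffel g b a c x * pd b φ x
      = ∑ b, (∑ a, ∑ c, (g x)⁻¹ a c * christoffel g b a c x) * pd b φ x := by
    simp_rw [Finset.mul_sum, Finset.sum_mul]
    rw [Finset.sum_comm' (t' := Finset.univ) (s' := fun _ => Finset.univ) (by simp)]
    rw [Finset.sum_comm]
    conv_rhs => rw [Finset.sum_comm]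
    refine Finset.sum_congr rfl fun a _ => ?_
    rw [Finset.sum_comm]
    refine Finset.sum_congr rfl fun c _ => Finset.sum_congr rfl fun l _ => ?_
    ring
  have e3 : ∑ a, (∑ c, christoffel g c c a x) * ∑ b, (g x)⁻¹ a b * pd b φ x
      = ∑ b, (∑ a, (g x)⁻¹ a b * ∑ c, christoffel g c c a x) * pd b φ x := by
    simp_rw [Finset.sum_mul _ _ (pd _ φ x), Finset.mul_sum Finset.univ (fun b => _ * pd b φ x)]
    rw [Finset.sum_comm]
    refine Finset.sum_congr rfl fun a _ => Finset.sum_congr rfl fun c _ => ?_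
    ring
  simp_rw [e1, e3, laplacian, hess, mul_sub, Finset.sum_sub_distrib, e2,
    hg.sum_inv_mul_christoffel, Finset.sum_add_distrib, sub_mul, neg_mul,
    Finset.sum_sub_distrib, Finset.sum_neg_distrib]
  have e4 : ∑ a, ∑ b, pd a (fun y => (g y)⁻¹ a b) x * pd b φ x
      = ∑ b, (∑ a, pd a (fun y => (g y)⁻¹ a b) x) * pd b φ x := by
    rw [Finset.sum_comm]
    simp_rw [Finset.sum_mul]
  rw [e4]
  ring

end CoordinateMetric

section ConformalMetric

variable {g : (ι → ℝ) → Matrix ι ι ℝ} {f : (ι → ℝ) → ℝ}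

lemma IsMetric.conformal (hg : IsMetric g) (hf : ContDiff ℝ (⊤ : ℕ∞) f)
    (hf0 : ∀ u, f u ≠ 0) : IsMetric fun u => f u ^ 2 • g u := by
  refine ⟨fun x => ?_, fun x => ?_, fun i j => ?_⟩
  · exact (hg.1 x).smul _
  · rw [Matrix.det_smul]
    exact (((hf0 x).isUnit.pow 2).pow _).mul (hg.2.1 x)
  · exact (hf.pow 2).mul (hg.2.2 i j)

lemma IsMetric.conformal_inv (hg : IsMetric g) (hf0 : ∀ u, f u ≠ 0) (x : ι → ℝ) :
    (f x ^ 2 • g x)⁻¹ = (f x ^ 2)⁻¹ • (g x)⁻¹ := by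
  refine Matrix.inv_eq_right_inv ?_
  rw [Matrix.smul_mul, Matrix.mul_smul, smul_smul, mul_inv_cancel₀ (pow_ne_zero 2 (hf0 x)),
    one_smul, Matrix.mul_nonsing_inv _ (hg.2.1 x)]

lemma IsMetric.sum_christoffel_contract_conformal (hg : IsMetric g)
    (hf : ContDiff ℝ (⊤ : ℕ∞) f) (hf0 : ∀ u, f u ≠ 0) (c : ι) (x : ι → ℝ) :
    ∑ a, christoffel (fun u => f u ^ 2 • g u) a a c x
      = ∑ a, christoffel g a a c x + Fintype.card ι * (pd c f x / f x) := by
  have df : DifferentiableAt ℝ f x := hf.differentiable (by simp) x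
  have hpd : ∀ a l, pd c (fun y => (f y ^ 2 • g y) a l) x
      = 2 * f x * pd c f x * g x a l + f x ^ 2 * pd c (fun y => g y a l) x := by
    intro a l
    have := pd_mul c (df.pow 2) ((hg.2.2 a l).differentiable (by simp) x)
    simp only [Pi.pow_apply] at this
    rw [← pd_sq c df]
    exact this
  have htr : ∑ a, ∑ l, (g x)⁻¹ a l * g x a l = Fintype.card ι := by
    have : ∀ a, ∑ l, (g x)⁻¹ a l * g x a l = 1 := fun a => by
      simp_rw [hg.symm_apply x a]
      rw [← Matrix.mul_apply, Matrix.nonsing_inv_mul _ (hg.2.1 x), Matrix.one_apply_eq]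
    simp [this]
  have h0 := hf0 x
  rw [(hg.conformal hf hf0).sum_christoffel_contract, hg.sum_christoffel_contract,
    ← htr, Finset.mul_sum, Finset.mul_sum, Finset.sum_mul, ← Finset.sum_add_distrib]
  refine Finset.sum_congr rfl fun a _ => ?_
  rw [Finset.mul_sum, Finset.mul_sum, Finset.sum_mul, ← Finset.sum_add_distrib]
  refine Finset.sum_congr rfl fun l _ => ?_
  rw [hpd, hg.conformal_inv hf0, Matrix.smul_apply, smul_eq_mul]
  field_simp
  ring

end ConformalMetric

section WarpedProduct

variable {m n : ℕ} {g : (Fin m → ℝ) → Matrix (Fin m) (Fin m) ℝ}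
  {h : (Fin n → ℝ) → Matrix (Fin n) (Fin n) ℝ} {f₁ f₂ : (Fin m → ℝ) → ℝ}

lemma bcwpMetric_inv (hg : IsMetric g) (hh : IsMetric h) (hf₁0 : ∀ u, f₁ u ≠ 0)
    (hf₂0 : ∀ u, f₂ u ≠ 0) (x : (Fin m ⊕ Fin n) → ℝ) :
    (bcwpMetric g h f₁ f₂ x)⁻¹
      = Matrix.fromBlocks ((f₁ (x ∘ Sum.inl) ^ 2 • g (x ∘ Sum.inl))⁻¹) 0 0
        ((f₂ (x ∘ Sum.inl) ^ 2)⁻¹ • (h (x ∘ Sum.inr))⁻¹) := by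
  refine Matrix.inv_eq_right_inv ?_
  rw [bcwpMetric, Matrix.fromBlocks_multiply, hg.conformal_inv hf₁0]
  simp [smul_smul, hf₁0, hf₂0, Matrix.mul_nonsing_inv _ (hg.2.1 _),
    Matrix.mul_nonsing_inv _ (hh.2.1 _), Matrix.fromBlocks_one]

lemma differentiableAt_comp_inl {φ : (Fin m → ℝ) → ℝ} {x : (Fin m ⊕ Fin n) → ℝ}
    (hφ : DifferentiableAt ℝ φ (x ∘ Sum.inl)) :
    DifferentiableAt ℝ (fun y : (Fin m ⊕ Fin n) → ℝ => φ (y ∘ Sum.inl)) x :=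
  (hasFDerivAt_precomp Sum.inl hφ).differentiableAt

lemma differentiableAt_comp_inr {ψ : (Fin n → ℝ) → ℝ} {x : (Fin m ⊕ Fin n) → ℝ}
    (hψ : DifferentiableAt ℝ ψ (x ∘ Sum.inr)) :
    DifferentiableAt ℝ (fun y : (Fin m ⊕ Fin n) → ℝ => ψ (y ∘ Sum.inr)) x :=
  (hasFDerivAt_precomp Sum.inr hψ).differentiableAt

lemma pd_inl_mul {φ : (Fin m → ℝ) → ℝ} {ψ : (Fin n → ℝ) → ℝ} {x : (Fin m ⊕ Fin n) → ℝ}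
    (hφ : DifferentiableAt ℝ φ (x ∘ Sum.inl)) (hψ : DifferentiableAt ℝ ψ (x ∘ Sum.inr))
    (a : Fin m) :
    pd (Sum.inl a) (fun y : (Fin m ⊕ Fin n) → ℝ => φ (y ∘ Sum.inl) * ψ (y ∘ Sum.inr)) x
      = pd a φ (x ∘ Sum.inl) * ψ (x ∘ Sum.inr) := by
  rw [pd_mul _ (differentiableAt_comp_inl hφ) (differentiableAt_comp_inr hψ),
    pd_precomp_apply Sum.inl_injective a hφ, pd_precomp_of_notMem_range (by simp) hψ]
  simp

lemma pd_inr_mul {φ : (Fin m → ℝ) → ℝ} {ψ : (Fin n → ℝ) → ℝ} {x : (Fin m ⊕ Fin n) → ℝ}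
    (hφ : DifferentiableAt ℝ φ (x ∘ Sum.inl)) (hψ : DifferentiableAt ℝ ψ (x ∘ Sum.inr))
    (α : Fin n) :
    pd (Sum.inr α) (fun y : (Fin m ⊕ Fin n) → ℝ => φ (y ∘ Sum.inl) * ψ (y ∘ Sum.inr)) x
      = φ (x ∘ Sum.inl) * pd α ψ (x ∘ Sum.inr) := by
  rw [pd_mul _ (differentiableAt_comp_inl hφ) (differentiableAt_comp_inr hψ),
    pd_precomp_apply Sum.inr_injective α hψ, pd_precomp_of_notMem_range (by simp) hφ]
  simp

lemma pd_inl_bcwpMetric_inl_inl (hg : IsMetric g) (hf₁ : ContDiff ℝ (⊤ : ℕ∞) f₁)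
    (c a b : Fin m) (x : (Fin m ⊕ Fin n) → ℝ) :
    pd (Sum.inl c) (fun y => bcwpMetric g h f₁ f₂ y (Sum.inl a) (Sum.inl b)) x
      = pd c (fun u => (f₁ u ^ 2 • g u) a b) (x ∘ Sum.inl) :=
  pd_precomp_apply (φ := fun u => (f₁ u ^ 2 • g u) a b) Sum.inl_injective c
    (((hf₁.pow 2).mul (hg.2.2 a b)).differentiable (by simp) _)

lemma pd_inr_bcwpMetric_inl_inl (hg : IsMetric g) (hf₁ : ContDiff ℝ (⊤ : ℕ∞) f₁)
    (γ : Fin n) (a b : Fin m) (x : (Fin m ⊕ Fin n) → ℝ) :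
    pd (Sum.inr γ) (fun y => bcwpMetric g h f₁ f₂ y (Sum.inl a) (Sum.inl b)) x = 0 :=
  pd_precomp_of_notMem_range (φ := fun u => (f₁ u ^ 2 • g u) a b) (by simp)
    (((hf₁.pow 2).mul (hg.2.2 a b)).differentiable (by simp) _)

lemma pd_inl_bcwpMetric_inr_inr (hh : IsMetric h) (hf₂ : ContDiff ℝ (⊤ : ℕ∞) f₂)
    (c : Fin m) (α β : Fin n) (x : (Fin m ⊕ Fin n) → ℝ) :
    pd (Sum.inl c) (fun y => bcwpMetric g h f₁ f₂ y (Sum.inr α) (Sum.inr β)) x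
      = 2 * f₂ (x ∘ Sum.inl) * pd c f₂ (x ∘ Sum.inl) * h (x ∘ Sum.inr) α β := by
  rw [← pd_sq c (hf₂.differentiable (by simp) _)]
  exact pd_inl_mul (φ := fun u => f₂ u ^ 2) (ψ := fun v => h v α β)
    ((hf₂.pow 2).differentiable (by simp) _) ((hh.2.2 α β).differentiable (by simp) _) c

lemma pd_inr_bcwpMetric_inr_inr (hh : IsMetric h) (hf₂ : ContDiff ℝ (⊤ : ℕ∞) f₂)
    (γ α β : Fin n) (x : (Fin m ⊕ Fin n) → ℝ) :
    pd (Sum.inr γ) (fun y => bcwpMetric g h f₁ f₂ y (Sum.inr α) (Sum.inr β)) x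
      = f₂ (x ∘ Sum.inl) ^ 2 * pd γ (fun v => h v α β) (x ∘ Sum.inr) :=
  pd_inr_mul (φ := fun u => f₂ u ^ 2) (ψ := fun v => h v α β)
    ((hf₂.pow 2).differentiable (by simp) _) ((hh.2.2 α β).differentiable (by simp) _) γ

lemma pd_bcwpMetric_inl_inr (k : Fin m ⊕ Fin n) (a : Fin m) (β : Fin n)
    (x : (Fin m ⊕ Fin n) → ℝ) :
    pd k (fun y => bcwpMetric g h f₁ f₂ y (Sum.inl a) (Sum.inr β)) x = 0 :=
  pd_const k 0 x

lemma pd_bcwpMetric_inr_inl (k : Fin m ⊕ Fin n) (α : Fin n) (b : Fin m)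
    (x : (Fin m ⊕ Fin n) → ℝ) :
    pd k (fun y => bcwpMetric g h f₁ f₂ y (Sum.inr α) (Sum.inl b)) x = 0 :=
  pd_const k 0 x

lemma christoffel_bcwp_inl_inl_inl (hg : IsMetric g) (hh : IsMetric h)
    (hf₁ : ContDiff ℝ (⊤ : ℕ∞) f₁) (hf₁0 : ∀ u, f₁ u ≠ 0) (hf₂0 : ∀ u, f₂ u ≠ 0)
    (a b c : Fin m) (x : (Fin m ⊕ Fin n) → ℝ) :
    christoffel (bcwpMetric g h f₁ f₂) (Sum.inl a) (Sum.inl b) (Sum.inl c) x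
      = christoffel (fun u => f₁ u ^ 2 • g u) a b c (x ∘ Sum.inl) := by
  simp [christoffel, bcwpMetric_inv hg hh hf₁0 hf₂0, pd_inl_bcwpMetric_inl_inl hg hf₁]

lemma christoffel_bcwp_inl_inl_inr (hg : IsMetric g) (hh : IsMetric h)
    (hf₁ : ContDiff ℝ (⊤ : ℕ∞) f₁) (hf₁0 : ∀ u, f₁ u ≠ 0) (hf₂0 : ∀ u, f₂ u ≠ 0)
    (a b : Fin m) (β : Fin n) :
    christoffel (bcwpMetric g h f₁ f₂) (Sum.inl a) (Sum.inl b) (Sum.inr β) = fun _ => 0 := by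
  funext x
  simp [christoffel, bcwpMetric_inv hg hh hf₁0 hf₂0, pd_inr_bcwpMetric_inl_inl hg hf₁,
    pd_bcwpMetric_inl_inr]

lemma christoffel_bcwp_inl_inr_inl (hg : IsMetric g) (hh : IsMetric h)
    (hf₁ : ContDiff ℝ (⊤ : ℕ∞) f₁) (hf₁0 : ∀ u, f₁ u ≠ 0) (hf₂0 : ∀ u, f₂ u ≠ 0)
    (a b : Fin m) (α : Fin n) :
    christoffel (bcwpMetric g h f₁ f₂) (Sum.inl a) (Sum.inr α) (Sum.inl b) = fun _ => 0 := by
  funext x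
  simp [christoffel, bcwpMetric_inv hg hh hf₁0 hf₂0, pd_inr_bcwpMetric_inl_inl hg hf₁,
    pd_bcwpMetric_inl_inr, pd_bcwpMetric_inr_inl]

lemma christoffel_bcwp_inl_inr_inr (hg : IsMetric g) (hh : IsMetric h)
    (hf₂ : ContDiff ℝ (⊤ : ℕ∞) f₂) (hf₁0 : ∀ u, f₁ u ≠ 0) (hf₂0 : ∀ u, f₂ u ≠ 0)
    (a : Fin m) (α β : Fin n) :
    christoffel (bcwpMetric g h f₁ f₂) (Sum.inl a) (Sum.inr α) (Sum.inr β)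
      = fun x => (-(f₂ (x ∘ Sum.inl) * (f₁ (x ∘ Sum.inl) ^ 2)⁻¹) *
          ∑ b, (g (x ∘ Sum.inl))⁻¹ a b * pd b f₂ (x ∘ Sum.inl)) * h (x ∘ Sum.inr) α β := by
  funext x
  simp only [christoffel, bcwpMetric_inv hg hh hf₁0 hf₂0, Fintype.sum_sum_type,
    Matrix.fromBlocks_apply₁₁, Matrix.fromBlocks_apply₁₂, Matrix.zero_apply, zero_mul,
    Finset.sum_const_zero, add_zero, pd_bcwpMetric_inl_inr, pd_inl_bcwpMetric_inr_inr hh hf₂,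
    hg.conformal_inv hf₁0, Matrix.smul_apply, smul_eq_mul, Finset.mul_sum, Finset.sum_mul]
  refine Finset.sum_congr rfl fun b _ => ?_
  ring

lemma christoffel_bcwp_inr_inl_inr (hg : IsMetric g) (hh : IsMetric h)
    (hf₂ : ContDiff ℝ (⊤ : ℕ∞) f₂) (hf₁0 : ∀ u, f₁ u ≠ 0) (hf₂0 : ∀ u, f₂ u ≠ 0)
    (γ β : Fin n) (a : Fin m) (x : (Fin m ⊕ Fin n) → ℝ) :
    christoffel (bcwpMetric g h f₁ f₂) (Sum.inr γ) (Sum.inl a) (Sum.inr β) x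
      = pd a f₂ (x ∘ Sum.inl) / f₂ (x ∘ Sum.inl) * (1 : Matrix (Fin n) (Fin n) ℝ) γ β := by
  have h0 := hf₂0 (x ∘ Sum.inl)
  rw [← Matrix.nonsing_inv_mul _ (hh.2.1 (x ∘ Sum.inr)), Matrix.mul_apply]
  simp only [christoffel, bcwpMetric_inv hg hh hf₁0 hf₂0, Fintype.sum_sum_type,
    Matrix.fromBlocks_apply₂₁, Matrix.fromBlocks_apply₂₂, Matrix.zero_apply, zero_mul,
    Finset.sum_const_zero, zero_add, add_zero, sub_zero, pd_bcwpMetric_inl_inr,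
    pd_bcwpMetric_inr_inl, pd_inl_bcwpMetric_inr_inr hh hf₂,
    Matrix.smul_apply, smul_eq_mul, Finset.mul_sum]
  refine Finset.sum_congr rfl fun δ _ => ?_
  field_simp

lemma christoffel_bcwp_inr_inr_inl (hg : IsMetric g) (hh : IsMetric h)
    (hf₂ : ContDiff ℝ (⊤ : ℕ∞) f₂) (hf₁0 : ∀ u, f₁ u ≠ 0) (hf₂0 : ∀ u, f₂ u ≠ 0)
    (γ β : Fin n) (a : Fin m) (x : (Fin m ⊕ Fin n) → ℝ) :
    christoffel (bcwpMetric g h f₁ f₂) (Sum.inr γ) (Sum.inr β) (Sum.inl a) x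
      = pd a f₂ (x ∘ Sum.inl) / f₂ (x ∘ Sum.inl) * (1 : Matrix (Fin n) (Fin n) ℝ) γ β := by
  rw [← christoffel_bcwp_inr_inl_inr hg hh hf₂ hf₁0 hf₂0]
  simp only [christoffel, Fintype.sum_sum_type, pd_bcwpMetric_inl_inr, pd_bcwpMetric_inr_inl,
    bcwpMetric_inv hg hh hf₁0 hf₂0, Matrix.fromBlocks_apply₂₁, Matrix.zero_apply, zero_mul,
    zero_add, add_zero]

lemma christoffel_bcwp_inr_inr_inr (hg : IsMetric g) (hh : IsMetric h)
    (hf₂ : ContDiff ℝ (⊤ : ℕ∞) f₂) (hf₁0 : ∀ u, f₁ u ≠ 0) (hf₂0 : ∀ u, f₂ u ≠ 0)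
    (γ α β : Fin n) :
    christoffel (bcwpMetric g h f₁ f₂) (Sum.inr γ) (Sum.inr α) (Sum.inr β)
      = fun x : (Fin m ⊕ Fin n) → ℝ => christoffel h γ α β (x ∘ Sum.inr) := by
  funext x
  have h0 := hf₂0 (x ∘ Sum.inl)
  simp only [christoffel, bcwpMetric_inv hg hh hf₁0 hf₂0, Fintype.sum_sum_type,
    Matrix.fromBlocks_apply₂₁, Matrix.fromBlocks_apply₂₂, Matrix.zero_apply, zero_mul,
    Finset.sum_const_zero, zero_add, pd_inr_bcwpMetric_inr_inr hh hf₂,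
    Matrix.smul_apply, smul_eq_mul, Finset.mul_sum]
  refine Finset.sum_congr rfl fun δ _ => ?_
  field_simp

/-- The divergence of `-(f₂ / f₁²) ∇f₂` with respect to the conformal metric `f₁² g`. -/
lemma IsMetric.sum_pd_scaled_grad (hg : IsMetric g) (hf₁ : ContDiff ℝ (⊤ : ℕ∞) f₁)
    (hf₂ : ContDiff ℝ (⊤ : ℕ∞) f₂) (hf₁0 : ∀ u, f₁ u ≠ 0) (u : Fin m → ℝ) :
    ∑ a, pd a (fun u => -(f₂ u * (f₁ u ^ 2)⁻¹) * ∑ b, (g u)⁻¹ a b * pd b f₂ u) u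
      + ∑ a, (∑ c, christoffel (fun u => f₁ u ^ 2 • g u) c c a u) *
          (-(f₂ u * (f₁ u ^ 2)⁻¹) * ∑ b, (g u)⁻¹ a b * pd b f₂ u)
      = -(gradInner g f₂ f₂ u / f₁ u ^ 2 + (m - 2) * f₂ u * gradInner g f₂ f₁ u / f₁ u ^ 3
          + f₂ u * laplacian g f₂ u / f₁ u ^ 2) := by
  have h0 := hf₁0 u
  have d1 : DifferentiableAt ℝ f₁ u := hf₁.differentiable (by simp) u
  have d2 : DifferentiableAt ℝ f₂ u := hf₂.differentiable (by simp) u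
  have dV : ∀ a, DifferentiableAt ℝ (fun u => ∑ b, (g u)⁻¹ a b * pd b f₂ u) u := fun a =>
    (ContDiff.sum fun b _ => (hg.contDiff_inv a b).mul (contDiff_pd b hf₂)).differentiable
      (by simp) u
  have hw : ∀ a, pd a (fun u => -(f₂ u * (f₁ u ^ 2)⁻¹)) u
      = -(pd a f₂ u / f₁ u ^ 2) + 2 * f₂ u * pd a f₁ u / f₁ u ^ 3 := by
    intro a
    have d1s : DifferentiableAt ℝ (fun u => f₁ u ^ 2) u := d1.pow 2
    have d1i : DifferentiableAt ℝ (fun u => (f₁ u ^ 2)⁻¹) u := d1s.inv (pow_ne_zero 2 h0)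
    have : (fun u => -(f₂ u * (f₁ u ^ 2)⁻¹)) = fun u => (-1) * (f₂ u * (f₁ u ^ 2)⁻¹) := by
      simp
    rw [this, pd_mul a (differentiableAt_const _) (d2.fun_mul d1i), pd_const,
      pd_mul a d2 d1i, pd_inv a d1s (pow_ne_zero 2 h0), pd_sq a d1]
    field_simp
    ring
  have dw : DifferentiableAt ℝ (fun u => -(f₂ u * (f₁ u ^ 2)⁻¹)) u :=
    (d2.fun_mul ((d1.pow 2).inv (pow_ne_zero 2 h0))).neg
  have hgrad : ∀ φ, gradInner g f₂ φ u = ∑ a, pd a φ u * ∑ b, (g u)⁻¹ a b * pd b f₂ u := by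
    intro φ
    rw [gradInner, Finset.sum_comm]
    refine Finset.sum_congr rfl fun a _ => ?_
    rw [Finset.mul_sum]
    refine Finset.sum_congr rfl fun b _ => ?_
    rw [hg.inv_symm_apply u b a]
    ring
  simp_rw [fun a => pd_mul a dw (dV a), hw,
    hg.sum_christoffel_contract_conformal hf₁ hf₁0, Fintype.card_fin, hgrad,
    hg.laplacian_eq_divergence hf₂]
  rw [← Finset.sum_add_distrib, ← Finset.sum_add_distrib]
  simp only [Finset.mul_sum Finset.univ (fun a => pd a _ u * _),
    Finset.mul_sum Finset.univ (fun a => pd a _ u + _), Finset.sum_div,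
    ← Finset.sum_add_distrib, ← Finset.sum_neg_distrib]
  refine Finset.sum_congr rfl fun a _ => ?_
  field_simp
  ring

end WarpedProduct

/-- fiber Ricci components of a base conformal warped product. -/
theorem bcwp_fiber_ricci {m n : ℕ}
    (g : (Fin m → ℝ) → Matrix (Fin m) (Fin m) ℝ)
    (h : (Fin n → ℝ) → Matrix (Fin n) (Fin n) ℝ)
    (f₁ f₂ : (Fin m → ℝ) → ℝ)
    (hg : IsMetric g) (hh : IsMetric h)
    (hf₁ : ContDiff ℝ (⊤ : ℕ∞) f₁) (hf₂ : ContDiff ℝ (⊤ : ℕ∞) f₂)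
    (hf₁pos : ∀ u, 0 < f₁ u) (hf₂pos : ∀ u, 0 < f₂ u) :
    ∀ (x : (Fin m ⊕ Fin n) → ℝ) (α β : Fin n),
      ricci (bcwpMetric g h f₁ f₂) (Sum.inr α) (Sum.inr β) x
        = ricci h α β (x ∘ Sum.inr)
          - ((f₂ (x ∘ Sum.inl)) ^ 2 / (f₁ (x ∘ Sum.inl)) ^ 2) * h (x ∘ Sum.inr) α β *
            (((m : ℝ) - 2) * gradInner g f₂ f₁ (x ∘ Sum.inl)
                / (f₁ (x ∘ Sum.inl) * f₂ (x ∘ Sum.inl))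
              + laplacian g f₂ (x ∘ Sum.inl) / f₂ (x ∘ Sum.inl)
              + ((n : ℝ) - 1) * gradInner g f₂ f₂ (x ∘ Sum.inl) / (f₂ (x ∘ Sum.inl)) ^ 2) := by
  intro x α β
  have hf₁0 : ∀ u, f₁ u ≠ 0 := fun u => (hf₁pos u).ne'
  have hf₂0 : ∀ u, f₂ u ≠ 0 := fun u => (hf₂pos u).ne'
  have h1 := hf₁0 (x ∘ Sum.inl)
  have h2 := hf₂0 (x ∘ Sum.inl)
  have dW : ∀ a, DifferentiableAt ℝ
      (fun u => -(f₂ u * (f₁ u ^ 2)⁻¹) * ∑ b, (g u)⁻¹ a b * pd b f₂ u) (x ∘ Sum.inl) := fun a =>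
    ((hf₂.mul ((hf₁.pow 2).inv fun u => pow_ne_zero 2 (hf₁0 u))).neg.mul
      (ContDiff.sum fun b _ => (hg.contDiff_inv a b).mul (contDiff_pd b hf₂))).differentiable
        (by simp) _
  have dh : DifferentiableAt ℝ (fun v => h v α β) (x ∘ Sum.inr) :=
    (hh.2.2 α β).differentiable (by simp) _
  have dΓ : ∀ γ δ ε, DifferentiableAt ℝ (christoffel h γ δ ε) (x ∘ Sum.inr) := fun γ δ ε =>
    (hh.contDiff_christoffel γ δ ε).differentiable (by simp) _
  have key := hg.sum_pd_scaled_grad hf₁ hf₂ hf₁0 (x ∘ Sum.inl)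
  have hgrad : gradInner g f₂ f₂ (x ∘ Sum.inl) = ∑ a, pd a f₂ (x ∘ Sum.inl) *
      ∑ b, (g (x ∘ Sum.inl))⁻¹ a b * pd b f₂ (x ∘ Sum.inl) := by
    simp_rw [gradInner, Finset.mul_sum]
    refine Finset.sum_congr rfl fun a _ => Finset.sum_congr rfl fun b _ => ?_
    ring
  rw [ricci]
  simp only [Fintype.sum_sum_type, christoffel_bcwp_inl_inr_inr hg hh hf₂ hf₁0 hf₂0,
    christoffel_bcwp_inr_inr_inr hg hh hf₂ hf₁0 hf₂0,
    christoffel_bcwp_inl_inr_inl hg hh hf₁ hf₁0 hf₂0,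
    christoffel_bcwp_inl_inl_inr hg hh hf₁ hf₁0 hf₂0,
    christoffel_bcwp_inl_inl_inl hg hh hf₁ hf₁0 hf₂0,
    christoffel_bcwp_inr_inr_inl hg hh hf₂ hf₁0 hf₂0,
    pd_const, pd_inl_mul (dW _) dh,
    fun γ δ ε κ => pd_precomp_apply (x := x) Sum.inr_injective κ (dΓ γ δ ε)]
  simp only [Finset.sum_add_distrib, Finset.sum_sub_distrib, ricci, zero_mul, mul_zero]
  set V : Fin m → ℝ := fun a => ∑ b, (g (x ∘ Sum.inl))⁻¹ a b * pd b f₂ (x ∘ Sum.inl) with hV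
  have hVa : ∀ a, ∑ b, (g (x ∘ Sum.inl))⁻¹ a b * pd b f₂ (x ∘ Sum.inl) = V a := fun _ => rfl
  simp only [hVa] at key hgrad ⊢
  set G := gradInner g f₂ f₂ (x ∘ Sum.inl) with hG
  set w := f₂ (x ∘ Sum.inl) * (f₁ (x ∘ Sum.inl) ^ 2)⁻¹ with hw
  have base : ∑ a, ∑ b, christoffel (fun u => f₁ u ^ 2 • g u) a a b (x ∘ Sum.inl) *
        (-w * V b * h (x ∘ Sum.inr) α β)
      = (∑ b, (∑ a, christoffel (fun u => f₁ u ^ 2 • g u) a a b (x ∘ Sum.inl)) * (-w * V b)) *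
          h (x ∘ Sum.inr) α β := by
    rw [Finset.sum_comm]
    simp only [Finset.sum_mul, mul_assoc]
  have mixed : ∀ c : ℝ, ∑ a, pd a f₂ (x ∘ Sum.inl) / f₂ (x ∘ Sum.inl) * (-w * V a * c)
      = -(w * G / f₂ (x ∘ Sum.inl) * c) := by
    intro c
    rw [hgrad, Finset.mul_sum, Finset.sum_div, Finset.sum_mul, ← Finset.sum_neg_distrib]
    refine Finset.sum_congr rfl fun a _ => ?_
    ring
  have trace : ∑ γ : Fin n, ∑ a, pd a f₂ (x ∘ Sum.inl) / f₂ (x ∘ Sum.inl) *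
        (1 : Matrix (Fin n) (Fin n) ℝ) γ γ * (-w * V a * h (x ∘ Sum.inr) α β)
      = n * -(w * G / f₂ (x ∘ Sum.inl) * h (x ∘ Sum.inr) α β) := by
    simp only [Matrix.one_apply_eq, mul_one, mixed]
    simp
  have cross : ∑ γ : Fin n, ∑ a, pd a f₂ (x ∘ Sum.inl) / f₂ (x ∘ Sum.inl) *
        (1 : Matrix (Fin n) (Fin n) ℝ) γ β * (-w * V a * h (x ∘ Sum.inr) α γ)
      = -(w * G / f₂ (x ∘ Sum.inl) * h (x ∘ Sum.inr) α β) := by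
    rw [Finset.sum_eq_single β (fun γ _ hγ => by simp [Matrix.one_apply_ne hγ]) (by simp)]
    simp only [Matrix.one_apply_eq, mul_one, mixed]
  have cross' : ∑ a, ∑ γ : Fin n, -w * V a * h (x ∘ Sum.inr) β γ *
        (pd a f₂ (x ∘ Sum.inl) / f₂ (x ∘ Sum.inl) * (1 : Matrix (Fin n) (Fin n) ℝ) γ α)
      = -(w * G / f₂ (x ∘ Sum.inl) * h (x ∘ Sum.inr) α β) := by
    rw [← mixed, hh.symm_apply _ α β]
    refine Finset.sum_congr rfl fun a _ => ?_
    rw [Finset.sum_eq_single α (fun γ _ hγ => by simp [Matrix.one_apply_ne hγ]) (by simp),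
      Matrix.one_apply_eq]
    ring
  rw [base, trace, cross, cross', ← Finset.sum_mul, eq_sub_of_add_eq key, hw]
  simp only [Finset.sum_const_zero]
  field_simp
  ring
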